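/- Consider the horizontally connected QCQP of Example 5.2 with p̂ = 3 sub-QCQPs and m = 7 constraints: minimize f¹₀(u¹) + f²₀(u²) + Σ_{q=1}^{3} (v^q)^T C^q_0 v^q subject to Σ_p f^p_k(u^p) = γ₁ for k = 1, Σ_p f^p_k(u^p) ≥ γ₂ for k = 2, and Σ_p f^p_k(u^p) ≤ γ_k for k = 3,...,7 (where f³_k(u³) = Σ_q (v^q)^T C^q_k v^q for u³ = (v¹,v²,v³)). Assume: (19) the upper-left n¹×n¹ block of B¹_k is positive semidefinite for all k = 0,...,7 (each f¹_k is convex) and B¹₁ = B¹₂ = O; (20) all off-diagonal elements of B²_k are nonpositive for all k = 0,...,7 and B²₁ = B²₂ = O; (21) C²₁ = O, C³₁ = O, and γ₁ ≠ 0; (22) C¹₂ and C³₂ are negative semidefinite and γ₂ > 0; (23) B¹₃, B²₃, C¹₃, and C²₃ are positive semidefinite and γ₃ < 0; (24) there is α > 0 with C^q₅ = α C^q₄ for q = 1,2,3; and (25) C^q₆ = C^q₇ = O for q = 1,2,3. If the associated SDP relaxation (with variables X¹ ∈ S^{n¹+1}_+, X² ∈ S^{n²+1}_+ having bottom-right entry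 1, and V¹, V², V³ positive semidefinite, objective Σ_{p=1,2} ⟨B^p₀, X^p⟩ + Σ_q ⟨C^q₀, V^q⟩, and constraints Σ_{p=1,2} ⟨B^p_k, X^p⟩ + Σ_q ⟨C^q_k, V^q⟩ related to γ_k by =, ≥, ≤, ≤, ≤, ≤, ≤ for k = 1,...,7) admits an optimal solution, then this SDP relaxation is exact: its optimal value equals the optimal value of the QCQP. -/

import Mathlib

open Matrix BigOperators

noncomputable section

/-- Trace inner product `⟨A,X⟩ = Σᵢⱼ Aᵢⱼ Xᵢⱼ`. -/
def mInner {N : ℕ} (A X : Matrix (Fin N) (Fin N) ℝ) : ℝ :=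
  ∑ i, ∑ j, A i j * X i j

/-- The quadratic function `u ↦ (u,1)ᵀ B (u,1)` on `ℝⁿ`. -/
def quadF {n : ℕ} (B : Matrix (Fin (n + 1)) (Fin (n + 1)) ℝ) (u : Fin n → ℝ) : ℝ :=
  Fin.snoc u 1 ⬝ᵥ (B *ᵥ Fin.snoc u 1)

/-- A relation on `ℝ` is standard if it is `≤`, `=`, or `≥`. -/
def IsStdRel (r : ℝ → ℝ → Prop) : Prop :=
  r = (· ≤ ·) ∨ r = (· = ·) ∨ r = (· ≥ ·)

/-- The relations of Example 5.2: `=` for `k = 1`, `≥` for `k = 2`, `≤` for `k = 3,…,7`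
(here indexed by `Fin 7`, so `k : Fin 7` stands for constraint `k+1`). -/
def relEx : Fin 7 → ℝ → ℝ → Prop := fun k =>
  if k = 0 then (· = ·) else if k = 1 then (· ≥ ·) else (· ≤ ·)

section Example52

variable (n1 n2 nb1 nb2 nb3 : ℕ)
  (B1 : Fin 8 → Matrix (Fin (n1 + 1)) (Fin (n1 + 1)) ℝ)
  (B2 : Fin 8 → Matrix (Fin (n2 + 1)) (Fin (n2 + 1)) ℝ)
  (C1 : Fin 8 → Matrix (Fin nb1) (Fin nb1) ℝ)
  (C2 : Fin 8 → Matrix (Fin nb2) (Fin nb2) ℝ)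
  (C3 : Fin 8 → Matrix (Fin nb3) (Fin nb3) ℝ)
  (γ : Fin 7 → ℝ)

/-- The `k`-th quadratic function `Σₚ fᵖₖ(uᵖ)` of the QCQP of Example 5.2
(with `u³ = (v¹, v², v³)` and `f³ₖ(u³) = Σ_q (v^q)ᵀ C^qₖ v^q`). -/
def exQuad (u1 : Fin n1 → ℝ) (u2 : Fin n2 → ℝ)
    (v1 : Fin nb1 → ℝ) (v2 : Fin nb2 → ℝ) (v3 : Fin nb3 → ℝ) (k : Fin 8) : ℝ :=
  quadF (B1 k) u1 + quadF (B2 k) u2 +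
    v1 ⬝ᵥ (C1 k *ᵥ v1) + v2 ⬝ᵥ (C2 k *ᵥ v2) + v3 ⬝ᵥ (C3 k *ᵥ v3)

/-- The optimal value of the QCQP of Example 5.2. -/
def exQCQPVal : EReal :=
  sInf {y : EReal | ∃ (u1 : Fin n1 → ℝ) (u2 : Fin n2 → ℝ)
      (v1 : Fin nb1 → ℝ) (v2 : Fin nb2 → ℝ) (v3 : Fin nb3 → ℝ),
    (∀ k : Fin 7,
      relEx k (exQuad n1 n2 nb1 nb2 nb3 B1 B2 C1 C2 C3 u1 u2 v1 v2 v3 k.succ) (γ k)) ∧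
    y = ((exQuad n1 n2 nb1 nb2 nb3 B1 B2 C1 C2 C3 u1 u2 v1 v2 v3 0 : ℝ) : EReal)}

/-- The `k`-th linear function of the SDP relaxation of Example 5.2. -/
def exLin (X1 : Matrix (Fin (n1 + 1)) (Fin (n1 + 1)) ℝ)
    (X2 : Matrix (Fin (n2 + 1)) (Fin (n2 + 1)) ℝ)
    (V1 : Matrix (Fin nb1) (Fin nb1) ℝ) (V2 : Matrix (Fin nb2) (Fin nb2) ℝ)
    (V3 : Matrix (Fin nb3) (Fin nb3) ℝ) (k : Fin 8) : ℝ :=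
  mInner (B1 k) X1 + mInner (B2 k) X2 +
    mInner (C1 k) V1 + mInner (C2 k) V2 + mInner (C3 k) V3

/-- Feasibility for the SDP relaxation of Example 5.2. -/
def exSDPRFeas (X1 : Matrix (Fin (n1 + 1)) (Fin (n1 + 1)) ℝ)
    (X2 : Matrix (Fin (n2 + 1)) (Fin (n2 + 1)) ℝ)
    (V1 : Matrix (Fin nb1) (Fin nb1) ℝ) (V2 : Matrix (Fin nb2) (Fin nb2) ℝ)
    (V3 : Matrix (Fin nb3) (Fin nb3) ℝ) : Prop :=
  X1.PosSemidef ∧ X1 (Fin.last n1) (Fin.last n1) = 1 ∧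
  X2.PosSemidef ∧ X2 (Fin.last n2) (Fin.last n2) = 1 ∧
  V1.PosSemidef ∧ V2.PosSemidef ∧ V3.PosSemidef ∧
  ∀ k : Fin 7,
    relEx k (exLin n1 n2 nb1 nb2 nb3 B1 B2 C1 C2 C3 X1 X2 V1 V2 V3 k.succ) (γ k)

/-- The optimal value of the SDP relaxation of Example 5.2. -/
def exSDPRVal : EReal :=
  sInf {y : EReal | ∃ (X1 : Matrix (Fin (n1 + 1)) (Fin (n1 + 1)) ℝ)
      (X2 : Matrix (Fin (n2 + 1)) (Fin (n2 + 1)) ℝ)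
      (V1 : Matrix (Fin nb1) (Fin nb1) ℝ) (V2 : Matrix (Fin nb2) (Fin nb2) ℝ)
      (V3 : Matrix (Fin nb3) (Fin nb3) ℝ),
    exSDPRFeas n1 n2 nb1 nb2 nb3 B1 B2 C1 C2 C3 γ X1 X2 V1 V2 V3 ∧
    y = ((exLin n1 n2 nb1 nb2 nb3 B1 B2 C1 C2 C3 X1 X2 V1 V2 V3 0 : ℝ) : EReal)}

end Example52

section RankReduction

open LinearMap (BilinForm)

lemma bilin_sqrt_smul {E : Type*} [AddCommGroup E] [Module ℝ E] (B : BilinForm ℝ E) (v : E)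
    {r : ℝ} (hr : 0 ≤ r) : B (√r • v) (√r • v) = r * B v v := by
  simp only [map_smul, LinearMap.smul_apply, smul_eq_mul]
  rw [← mul_assoc, Real.mul_self_sqrt hr]

/-- A positive semidefinite `2 × 2` combination of two vectors is a sum of two squares, and a single
square suffices when the `2 × 2` matrix is singular. -/
lemma exists_squares_of_psd_two {κ E : Type*} [AddCommGroup E] [Module ℝ E]
    (B : κ → BilinForm ℝ E) (hB : ∀ k u v, B k u v = B k v u) (a b : E) {x y z : ℝ}
    (hx : 0 ≤ x) (hy : 0 ≤ y) (hz : z ^ 2 ≤ x * y) :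
    ∃ u w : E, (∀ k, B k u u + B k w w = x * B k a a + y * B k b b + 2 * z * B k a b) ∧
      (z ^ 2 = x * y → w = 0) := by
  rcases hx.eq_or_lt with rfl | hx
  · have hz0 : z = 0 := by nlinarith
    refine ⟨√y • b, 0, fun k => ?_, fun _ => rfl⟩
    have := Real.mul_self_sqrt hy
    simp only [map_smul, LinearMap.smul_apply, smul_eq_mul, map_zero, hz0]
    linear_combination B k b b * this
  · have hs : 0 < √x := Real.sqrt_pos.2 hx
    have h1 := Real.mul_self_sqrt hx.le
    have hd : 0 ≤ y - z ^ 2 / x := by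
      rw [sub_nonneg, div_le_iff₀ hx]; linarith
    have h2 := Real.mul_self_sqrt hd
    refine ⟨√x • a + (z / √x) • b, √(y - z ^ 2 / x) • b, fun k => ?_, fun h => ?_⟩
    · have h3 : √x * (z / √x) = z := by field_simp
      have h4 : (z / √x) * (z / √x) = z ^ 2 / x := by
        rw [div_mul_div_comm, h1, sq]
      simp only [map_add, map_smul, LinearMap.add_apply, LinearMap.smul_apply, smul_eq_mul,
        hB k b a]
      linear_combination B k a a * h1 + B k b b * h2 + 2 * B k a b * h3 + B k b b * h4
    · have : y - z ^ 2 / x = 0 := by rw [h]; field_simp; ring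
      simp [this]

/-- Moving from the identity in the direction of a block matrix that is not positive semidefinite,
one reaches a singular positive semidefinite matrix. -/
lemma exists_boundary_step {x y z p s : ℝ}
    (h : ¬ (0 ≤ x ∧ 0 ≤ y ∧ z ^ 2 ≤ x * y ∧ 0 ≤ p ∧ 0 ≤ s)) :
    ∃ t : ℝ, 0 < t ∧ 0 ≤ 1 + t * x ∧ 0 ≤ 1 + t * y ∧
      (t * z) ^ 2 ≤ (1 + t * x) * (1 + t * y) ∧ 0 ≤ 1 + t * p ∧ 0 ≤ 1 + t * s ∧
      ((t * z) ^ 2 = (1 + t * x) * (1 + t * y) ∨ 1 + t * p = 0 ∨ 1 + t * s = 0) := by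
  obtain ⟨μ, hμx, hμy, hμ⟩ : ∃ μ, μ ≤ x ∧ μ ≤ y ∧ (x - μ) * (y - μ) = z ^ 2 := by
    have hn : 0 ≤ (x - y) ^ 2 + 4 * z ^ 2 := by positivity
    have h1 := Real.sq_sqrt hn
    have h2 : |x - y| ≤ √((x - y) ^ 2 + 4 * z ^ 2) :=
      Real.abs_le_sqrt (by nlinarith [sq_nonneg z])
    have h3 := abs_le.1 h2
    refine ⟨((x + y) - √((x - y) ^ 2 + 4 * z ^ 2)) / 2, by linarith, by linarith, ?_⟩
    linear_combination h1 / 4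
  obtain ⟨m, hm, hmμ, hmp, hms, hme⟩ :
      ∃ m : ℝ, m < 0 ∧ m ≤ μ ∧ m ≤ p ∧ m ≤ s ∧ (m = μ ∨ m = p ∨ m = s) := by
    refine ⟨min μ (min p s), ?_, min_le_left _ _, (min_le_right _ _).trans (min_le_left _ _),
      (min_le_right _ _).trans (min_le_right _ _), ?_⟩
    · by_contra! hc
      rw [le_min_iff, le_min_iff] at hc
      obtain ⟨h0, hp, hs⟩ := hc
      exact h ⟨by linarith, by linarith, by nlinarith, hp, hs⟩
    · rcases min_choice μ (min p s) with h1 | h1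
      · exact Or.inl h1
      · rw [h1]
        exact Or.inr (min_choice p s)
  have ht : 0 < -(1 / m) := by
    rw [neg_pos]; exact one_div_neg.2 hm
  have key : ∀ r, 1 + -(1 / m) * r = -(1 / m) * (r - m) := by
    intro r; field_simp [hm.ne]; ring
  have hmono : z ^ 2 ≤ (x - m) * (y - m) := by
    rw [← hμ]
    exact mul_le_mul (by linarith) (by linarith) (by linarith) (by linarith)
  refine ⟨-(1 / m), ht, ?_, ?_, ?_, ?_, ?_, ?_⟩
  · rw [key]; exact mul_nonneg ht.le (by linarith)
  · rw [key]; exact mul_nonneg ht.le (by linarith)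
  · rw [key, key]; nlinarith [mul_le_mul_of_nonneg_left hmono (sq_nonneg (-(1 / m)))]
  · rw [key]; exact mul_nonneg ht.le (by linarith)
  · rw [key]; exact mul_nonneg ht.le (by linarith)
  · rcases hme with rfl | rfl | rfl
    · left; rw [key, key]; linear_combination -(-(1 / m)) ^ 2 * hμ
    · right; left; rw [key]; ring
    · right; right; rw [key]; ring

/-- Four homogeneous linear equations in five unknowns have a nonzero solution. -/
lemma exists_ne_zero_kernel (A B Z C D : Fin 4 → ℝ) :
    ∃ x y z p s : ℝ, ¬ (x = 0 ∧ y = 0 ∧ z = 0 ∧ p = 0 ∧ s = 0) ∧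
      ∀ j, x * A j + y * B j + z * Z j + p * C j + s * D j = 0 := by
  let M : Matrix (Fin 4) (Fin 5) ℝ := Matrix.of fun j => ![A j, B j, Z j, C j, D j]
  have hker : LinearMap.ker M.mulVecLin ≠ ⊥ :=
    LinearMap.ker_ne_bot_of_finrank_lt (by simp)
  obtain ⟨v, hv, hv0⟩ := (Submodule.ne_bot_iff _).1 hker
  refine ⟨v 0, v 1, v 2, v 3, v 4, fun h => hv0 ?_, fun j => ?_⟩
  · obtain ⟨h0, h1, h2, h3, h4⟩ := h
    ext i
    fin_cases i <;> simpa
  · have := congrFun (LinearMap.mem_ker.1 hv) j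
    simp only [Matrix.mulVecLin_apply, Matrix.mulVec, dotProduct, Fin.sum_univ_five, M,
      Pi.zero_apply] at this
    simp at this
    linarith

/-- The sum of the values of a quadratic form over a list of vectors. -/
def squareSum {E : Type*} [AddCommGroup E] [Module ℝ E] (B : BilinForm ℝ E) (l : List E) : ℝ :=
  (l.map fun v => B v v).sum

@[simp] lemma squareSum_nil {E : Type*} [AddCommGroup E] [Module ℝ E] (B : BilinForm ℝ E) :
    squareSum B [] = 0 := by simp [squareSum]

@[simp] lemma squareSum_cons {E : Type*} [AddCommGroup E] [Module ℝ E] (B : BilinForm ℝ E)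
    (v : E) (l : List E) : squareSum B (v :: l) = B v v + squareSum B l := by simp [squareSum]

@[simp] lemma squareSum_append {E : Type*} [AddCommGroup E] [Module ℝ E] (B : BilinForm ℝ E)
    (l l' : List E) : squareSum B (l ++ l') = squareSum B l + squareSum B l' := by
  simp [squareSum]

variable {E F G : Type*} [AddCommGroup E] [Module ℝ E] [AddCommGroup F] [Module ℝ F]
  [AddCommGroup G] [Module ℝ G]

/-- Four vectors, two of them in the same block, can be improved: either the objective (index `0`)
strictly decreases, or it does not increase and fewer vectors are needed, while the four
constraint values are kept. -/
lemma exists_improved_four_vectors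
    (P : Fin 5 → BilinForm ℝ E) (Q : Fin 5 → BilinForm ℝ F) (R : Fin 5 → BilinForm ℝ G)
    (hP : ∀ k u v, P k u v = P k v u) (a b : E) (c : F) (d : G) :
    ∃ (l₁ : List E) (l₂ : List F) (l₃ : List G),
      (∀ j : Fin 4, squareSum (P j.succ) l₁ + squareSum (Q j.succ) l₂ + squareSum (R j.succ) l₃ =
        P j.succ a a + P j.succ b b + Q j.succ c c + R j.succ d d) ∧
      (squareSum (P 0) l₁ + squareSum (Q 0) l₂ + squareSum (R 0) l₃ <
          P 0 a a + P 0 b b + Q 0 c c + R 0 d d ∨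
        squareSum (P 0) l₁ + squareSum (Q 0) l₂ + squareSum (R 0) l₃ ≤
          P 0 a a + P 0 b b + Q 0 c c + R 0 d d ∧
        l₁.length + l₂.length + l₃.length < 4) := by
  obtain ⟨x, y, z, p, s, hne, hk, h0⟩ : ∃ x y z p s : ℝ,
      (¬ (x = 0 ∧ y = 0 ∧ z = 0 ∧ p = 0 ∧ s = 0)) ∧
      (∀ j : Fin 4, x * P j.succ a a + y * P j.succ b b + 2 * z * P j.succ a b +
        p * Q j.succ c c + s * R j.succ d d = 0) ∧
      (x * P 0 a a + y * P 0 b b + 2 * z * P 0 a b + p * Q 0 c c + s * R 0 d d < 0 ∨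
        x * P 0 a a + y * P 0 b b + 2 * z * P 0 a b + p * Q 0 c c + s * R 0 d d = 0 ∧
        ¬ (0 ≤ x ∧ 0 ≤ y ∧ z ^ 2 ≤ x * y ∧ 0 ≤ p ∧ 0 ≤ s)) := by
    obtain ⟨x, y, z, p, s, hne, hk⟩ := exists_ne_zero_kernel
      (fun j => P j.succ a a) (fun j => P j.succ b b) (fun j => 2 * P j.succ a b)
      (fun j => Q j.succ c c) (fun j => R j.succ d d)
    rcases lt_trichotomy
      (x * P 0 a a + y * P 0 b b + 2 * z * P 0 a b + p * Q 0 c c + s * R 0 d d) 0 with h | h | h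
    · exact ⟨x, y, z, p, s, hne, fun j => by linear_combination hk j, Or.inl h⟩
    · by_cases hpsd : 0 ≤ x ∧ 0 ≤ y ∧ z ^ 2 ≤ x * y ∧ 0 ≤ p ∧ 0 ≤ s
      · refine ⟨-x, -y, -z, -p, -s, by simpa using hne,
          fun j => by linear_combination - hk j,
          Or.inr ⟨by linear_combination - h, fun hneg => hne ?_⟩⟩
        obtain ⟨h1, h2, h3, h4, h5⟩ := hpsd
        obtain ⟨g1, g2, -, g4, g5⟩ := hneg
        have hx : x = 0 := by linarith
        have hz : z = 0 := by rw [hx] at h3; nlinarith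
        exact ⟨hx, by linarith, hz, by linarith, by linarith⟩
      · exact ⟨x, y, z, p, s, hne, fun j => by linear_combination hk j, Or.inr ⟨h, hpsd⟩⟩
    · exact ⟨-x, -y, -z, -p, -s, by simpa using hne,
        fun j => by linear_combination - hk j, Or.inl (by linarith)⟩
  by_cases hpsd : 0 ≤ x ∧ 0 ≤ y ∧ z ^ 2 ≤ x * y ∧ 0 ≤ p ∧ 0 ≤ s
  · obtain ⟨h1, h2, h3, h4, h5⟩ := id hpsd
    obtain ⟨u, w, huw, -⟩ := exists_squares_of_psd_two P hP a b (x := 1 + x) (y := 1 + y) (z := z)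
      (by linarith) (by linarith) (by nlinarith)
    refine ⟨[u, w], [√(1 + p) • c], [√(1 + s) • d], fun j => ?_, Or.inl ?_⟩
    · simp only [squareSum_cons, squareSum_nil, bilin_sqrt_smul (R _) d (by linarith : 0 ≤ 1 + s),
        bilin_sqrt_smul (Q _) c (by linarith : 0 ≤ 1 + p)]
      linear_combination huw j.succ + hk j
    · simp only [squareSum_cons, squareSum_nil, bilin_sqrt_smul (R _) d (by linarith : 0 ≤ 1 + s),
        bilin_sqrt_smul (Q _) c (by linarith : 0 ≤ 1 + p)]
      rcases h0 with h0 | h0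
      · linarith [huw 0]
      · exact absurd hpsd h0.2
  · obtain ⟨t, ht, h1, h2, h3, h4, h5, heq⟩ := exists_boundary_step hpsd
    obtain ⟨u, w, huw, hw⟩ := exists_squares_of_psd_two P hP a b h1 h2 h3
    have hle : x * P 0 a a + y * P 0 b b + 2 * z * P 0 a b + p * Q 0 c c + s * R 0 d d ≤ 0 :=
      h0.elim le_of_lt fun h => h.1.le
    have hle := mul_nonpos_of_nonneg_of_nonpos ht.le hle
    have hfull : ∀ k, P k u u + P k w w + (1 + t * p) * Q k c c + (1 + t * s) * R k d d =
        P k a a + P k b b + Q k c c + R k d d +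
        t * (x * P k a a + y * P k b b + 2 * z * P k a b + p * Q k c c + s * R k d d) := by
      intro k; linear_combination huw k
    rcases heq with heq | heq | heq
    · have hw0 := hw heq
      subst hw0
      simp only [map_zero] at hfull
      refine ⟨[u], [√(1 + t * p) • c], [√(1 + t * s) • d], fun j => ?_, Or.inr ⟨?_, by simp⟩⟩
      · simp only [squareSum_cons, squareSum_nil, bilin_sqrt_smul (R _) d h5,
          bilin_sqrt_smul (Q _) c h4]
        linear_combination hfull j.succ + t * hk j
      · simp only [squareSum_cons, squareSum_nil, bilin_sqrt_smul (R _) d h5,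
          bilin_sqrt_smul (Q _) c h4]
        linarith [hfull 0]
    · rw [heq] at hfull
      refine ⟨[u, w], [], [√(1 + t * s) • d], fun j => ?_, Or.inr ⟨?_, by simp⟩⟩
      · simp only [squareSum_cons, squareSum_nil, bilin_sqrt_smul (R _) d h5]
        linear_combination hfull j.succ + t * hk j
      · simp only [squareSum_cons, squareSum_nil, bilin_sqrt_smul (R _) d h5]
        linarith [hfull 0]
    · rw [heq] at hfull
      refine ⟨[u, w], [√(1 + t * p) • c], [], fun j => ?_, Or.inr ⟨?_, by simp⟩⟩
      · simp only [squareSum_cons, squareSum_nil, bilin_sqrt_smul (Q _) c h4]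
        linear_combination hfull j.succ + t * hk j
      · simp only [squareSum_cons, squareSum_nil, bilin_sqrt_smul (Q _) c h4]
        linarith [hfull 0]

/-- If four constraints force three semidefinite blocks to be nonzero, an optimal solution can be
chosen with every block of rank one. -/
theorem exists_rank_one_solution
    (P : Fin 5 → BilinForm ℝ E) (Q : Fin 5 → BilinForm ℝ F) (R : Fin 5 → BilinForm ℝ G)
    (hP : ∀ k u v, P k u v = P k v u) (hQ : ∀ k u v, Q k u v = Q k v u)
    (hR : ∀ k u v, R k u v = R k v u) (b : Fin 4 → ℝ) (opt : ℝ)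
    (hne : ∀ l₁ l₂ l₃, (∀ j : Fin 4, squareSum (P j.succ) l₁ + squareSum (Q j.succ) l₂ +
      squareSum (R j.succ) l₃ = b j) → l₁ ≠ [] ∧ l₂ ≠ [] ∧ l₃ ≠ [])
    (hopt : ∀ l₁ l₂ l₃, (∀ j : Fin 4, squareSum (P j.succ) l₁ + squareSum (Q j.succ) l₂ +
      squareSum (R j.succ) l₃ = b j) →
      opt ≤ squareSum (P 0) l₁ + squareSum (Q 0) l₂ + squareSum (R 0) l₃)
    (l₁ : List E) (l₂ : List F) (l₃ : List G)
    (hfeas : ∀ j : Fin 4, squareSum (P j.succ) l₁ + squareSum (Q j.succ) l₂ +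
      squareSum (R j.succ) l₃ = b j)
    (hobj : squareSum (P 0) l₁ + squareSum (Q 0) l₂ + squareSum (R 0) l₃ ≤ opt) :
    ∃ u v w, (∀ j : Fin 4, P j.succ u u + Q j.succ v v + R j.succ w w = b j) ∧
      P 0 u u + Q 0 v v + R 0 w w ≤ opt := by
  induction hn : l₁.length + l₂.length + l₃.length using Nat.strong_induction_on
    generalizing l₁ l₂ l₃ with
  | _ n ih =>
  subst hn
  obtain ⟨h1, h2, h3⟩ := hne l₁ l₂ l₃ hfeas
  obtain ⟨u, l₁, rfl⟩ := List.exists_cons_of_ne_nil h1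
  obtain ⟨v, l₂, rfl⟩ := List.exists_cons_of_ne_nil h2
  obtain ⟨w, l₃, rfl⟩ := List.exists_cons_of_ne_nil h3
  simp only [squareSum_cons] at hfeas hobj
  have finish : ∀ (m₁ : List E) (m₂ : List F) (m₃ : List G),
      (∀ j : Fin 4, squareSum (P j.succ) m₁ + squareSum (Q j.succ) m₂ +
        squareSum (R j.succ) m₃ = b j) →
      (squareSum (P 0) m₁ + squareSum (Q 0) m₂ + squareSum (R 0) m₃ < opt ∨
        squareSum (P 0) m₁ + squareSum (Q 0) m₂ + squareSum (R 0) m₃ ≤ opt ∧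
        m₁.length + m₂.length + m₃.length <
          (u :: l₁).length + (v :: l₂).length + (w :: l₃).length) →
      ∃ u v w, (∀ j : Fin 4, P j.succ u u + Q j.succ v v + R j.succ w w = b j) ∧
        P 0 u u + Q 0 v v + R 0 w w ≤ opt := by
    intro m₁ m₂ m₃ hm hor
    rcases hor with hlt | ⟨hle, hlen⟩
    · exact absurd (hopt _ _ _ hm) (not_le.2 hlt)
    · exact ih _ hlen m₁ m₂ m₃ hm hle rfl
  rcases l₁ with _ | ⟨u', l₁⟩
  · rcases l₂ with _ | ⟨v', l₂⟩
    · rcases l₃ with _ | ⟨w', l₃⟩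
      · simp only [squareSum_nil, add_zero] at hfeas hobj
        exact ⟨u, v, w, hfeas, hobj⟩
      · obtain ⟨m₁, m₂, m₃, hm, hor⟩ := exists_improved_four_vectors R P Q hR w w' u v
        simp only [squareSum_cons, squareSum_nil, add_zero] at hfeas hobj
        refine finish m₂ m₃ (m₁ ++ l₃) (fun j => ?_) ?_
        · simp only [squareSum_append]; linarith [hfeas j, hm j]
        · simp only [squareSum_append, List.length_append, List.length_cons, List.length_nil]
          exact hor.imp (fun h => by linarith) fun h => ⟨by linarith [h.1], by omega⟩
    · obtain ⟨m₁, m₂, m₃, hm, hor⟩ := exists_improved_four_vectors Q P R hQ v v' u w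
      simp only [squareSum_cons, squareSum_nil, add_zero] at hfeas hobj
      refine finish m₂ (m₁ ++ l₂) (m₃ ++ l₃) (fun j => ?_) ?_
      · simp only [squareSum_append]; linarith [hfeas j, hm j]
      · simp only [squareSum_append, List.length_append, List.length_cons, List.length_nil]
        exact hor.imp (fun h => by linarith) fun h => ⟨by linarith [h.1], by omega⟩
  · obtain ⟨m₁, m₂, m₃, hm, hor⟩ := exists_improved_four_vectors P Q R hP u u' v w
    simp only [squareSum_cons] at hfeas hobj
    refine finish (m₁ ++ l₁) (m₂ ++ l₂) (m₃ ++ l₃) (fun j => ?_) ?_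
    · simp only [squareSum_append]; linarith [hfeas j, hm j]
    · simp only [squareSum_append, List.length_append, List.length_cons]
      exact hor.imp (fun h => by linarith) fun h => ⟨by linarith [h.1], by omega⟩

end RankReduction

section SemidefiniteMatrices

/-- A positive semidefinite matrix is a Gram matrix. -/
lemma exists_gram_of_posSemidef {N : ℕ} {X : Matrix (Fin N) (Fin N) ℝ} (hX : X.PosSemidef) :
    ∃ (m : ℕ) (A : Matrix (Fin m) (Fin N) ℝ), ∀ i j, X i j = ∑ k, A k i * A k j := by
  obtain ⟨m, A, rfl⟩ := Matrix.posSemidef_iff_eq_sum_vecMulVec.1 hX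
  exact ⟨m, A, fun i j => by simp [Matrix.sum_apply, Matrix.vecMulVec_apply]⟩

lemma mInner_gram {N M : ℕ} (C X : Matrix (Fin N) (Fin N) ℝ) (A : Matrix (Fin M) (Fin N) ℝ)
    (h : ∀ i j, X i j = ∑ k, A k i * A k j) :
    mInner C X = ∑ k, Matrix.toBilin' C (A k) (A k) := by
  simp only [mInner, Matrix.toBilin'_apply, h, Finset.mul_sum]
  symm
  rw [Finset.sum_comm]
  refine Finset.sum_congr rfl fun i _ => ?_
  rw [Finset.sum_comm]
  exact Finset.sum_congr rfl fun j _ => Finset.sum_congr rfl fun k _ => by ring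

lemma toBilin'_self {N : ℕ} (C : Matrix (Fin N) (Fin N) ℝ) (v : Fin N → ℝ) :
    Matrix.toBilin' C v v = v ⬝ᵥ (C *ᵥ v) := Matrix.toBilin'_apply' C v v

lemma toBilin'_comm {N : ℕ} {C : Matrix (Fin N) (Fin N) ℝ} (hC : C.IsSymm) (u v : Fin N → ℝ) :
    Matrix.toBilin' C u v = Matrix.toBilin' C v u := by
  rw [Matrix.toBilin'_apply', Matrix.toBilin'_apply', Matrix.dotProduct_mulVec,
    ← Matrix.mulVec_transpose, hC.eq, dotProduct_comm]

lemma mInner_vecMulVec {N : ℕ} (C : Matrix (Fin N) (Fin N) ℝ) (v : Fin N → ℝ) :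
    mInner C (Matrix.vecMulVec v v) = v ⬝ᵥ (C *ᵥ v) := by
  simp only [mInner, Matrix.vecMulVec_apply, dotProduct, Matrix.mulVec, Finset.mul_sum]
  exact Finset.sum_congr rfl fun i _ => Finset.sum_congr rfl fun j _ => by ring

lemma posSemidef_vecMulVec_self {N : ℕ} (v : Fin N → ℝ) :
    (Matrix.vecMulVec v v).PosSemidef := by
  simpa using Matrix.posSemidef_vecMulVec_self_star v

lemma mInner_add_right {N : ℕ} (C X Y : Matrix (Fin N) (Fin N) ℝ) :
    mInner C (X + Y) = mInner C X + mInner C Y := by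
  simp [mInner, mul_add, Finset.sum_add_distrib]

@[simp] lemma mInner_zero_left {N : ℕ} (X : Matrix (Fin N) (Fin N) ℝ) : mInner 0 X = 0 := by
  simp [mInner]

/-- A positive semidefinite matrix acts on symmetric matrices as a list of vectors does. -/
lemma exists_list_of_posSemidef {N : ℕ} {X : Matrix (Fin N) (Fin N) ℝ} (hX : X.PosSemidef) :
    ∃ l : List (Fin N → ℝ), ∀ C, squareSum (Matrix.toBilin' C) l = mInner C X := by
  obtain ⟨_, A, hA⟩ := exists_gram_of_posSemidef hX
  refine ⟨List.ofFn fun k => A k, fun C => ?_⟩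
  rw [mInner_gram C X A hA, squareSum, List.map_ofFn, List.sum_ofFn]
  rfl

lemma exists_posSemidef_of_list {N : ℕ} (l : List (Fin N → ℝ)) :
    ∃ X : Matrix (Fin N) (Fin N) ℝ, X.PosSemidef ∧
      ∀ C, mInner C X = squareSum (Matrix.toBilin' C) l := by
  induction l with
  | nil => exact ⟨0, Matrix.PosSemidef.zero, fun C => by simp [mInner]⟩
  | cons v l ih =>
    obtain ⟨X, hX, h⟩ := ih
    exact ⟨Matrix.vecMulVec v v + X, (posSemidef_vecMulVec_self v).add hX, fun C => by
      rw [mInner_add_right, mInner_vecMulVec, h, squareSum_cons, toBilin'_self]⟩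

lemma dotProduct_mulVec_nonneg {N : ℕ} {C : Matrix (Fin N) (Fin N) ℝ} (hC : C.PosSemidef)
    (v : Fin N → ℝ) : 0 ≤ v ⬝ᵥ (C *ᵥ v) := by
  simpa using hC.dotProduct_mulVec_nonneg v

lemma squareSum_nonneg {N : ℕ} {C : Matrix (Fin N) (Fin N) ℝ} (hC : C.PosSemidef)
    (l : List (Fin N → ℝ)) : 0 ≤ squareSum (Matrix.toBilin' C) l :=
  List.sum_nonneg fun r hr => by
    obtain ⟨v, -, rfl⟩ := List.mem_map.1 hr
    rw [toBilin'_self]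
    exact dotProduct_mulVec_nonneg hC v

lemma squareSum_toBilin'_smul {N : ℕ} (r : ℝ) (C : Matrix (Fin N) (Fin N) ℝ)
    (l : List (Fin N → ℝ)) :
    squareSum (Matrix.toBilin' (r • C)) l = r * squareSum (Matrix.toBilin' C) l := by
  induction l with
  | nil => simp
  | cons v l ih =>
    rw [squareSum_cons, squareSum_cons, ih, map_smul, LinearMap.smul_apply, LinearMap.smul_apply,
      smul_eq_mul, mul_add]

lemma squareSum_toBilin'_zero {N : ℕ} (l : List (Fin N → ℝ)) :
    squareSum (Matrix.toBilin' (0 : Matrix (Fin N) (Fin N) ℝ)) l = 0 := by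
  simpa using squareSum_toBilin'_smul 0 (0 : Matrix (Fin N) (Fin N) ℝ) l

lemma squareSum_toBilin'_neg {N : ℕ} (C : Matrix (Fin N) (Fin N) ℝ) (l : List (Fin N → ℝ)) :
    squareSum (Matrix.toBilin' (-C)) l = -squareSum (Matrix.toBilin' C) l := by
  simpa using squareSum_toBilin'_smul (-1) C l

/-- If the quadratic part is convex, the last column of a feasible matrix gives a vector whose
quadratic function values are no larger. -/
lemma exists_quadF_le_of_convex {n : ℕ} {κ : Type*} (B : κ → Matrix (Fin (n + 1)) (Fin (n + 1)) ℝ)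
    (hsymm : ∀ k, (B k).IsSymm)
    (hconv : ∀ k, ((B k).submatrix Fin.castSucc Fin.castSucc).PosSemidef)
    {X : Matrix (Fin (n + 1)) (Fin (n + 1)) ℝ} (hX : X.PosSemidef)
    (hX1 : X (Fin.last n) (Fin.last n) = 1) :
    ∃ u : Fin n → ℝ, ∀ k, quadF (B k) u ≤ mInner (B k) X := by
  obtain ⟨_, A, hA⟩ := exists_gram_of_posSemidef hX
  let x : Fin (n + 1) → ℝ := ∑ i, A i (Fin.last n) • A i
  have hx1 : x (Fin.last n) = 1 := by
    rw [← hX1, hA]; simp [x, Finset.sum_apply]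
  refine ⟨Fin.init x, fun k => ?_⟩
  have hxs : (Fin.snoc (Fin.init x) 1 : Fin (n + 1) → ℝ) = x := by
    rw [← hx1]; exact Fin.snoc_init_self x
  rw [quadF, hxs, ← toBilin'_self, mInner_gram _ _ A hA]
  have hnn : ∀ i, 0 ≤ Matrix.toBilin' (B k) (A i - A i (Fin.last n) • x)
      (A i - A i (Fin.last n) • x) := by
    intro i
    set y := A i - A i (Fin.last n) • x with hy
    have hy0 : y (Fin.last n) = 0 := by simp [hy, hx1]
    have := dotProduct_mulVec_nonneg (hconv k) (Fin.init y)
    rw [toBilin'_self]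
    convert this using 1
    simp [dotProduct, Matrix.mulVec, Fin.sum_univ_castSucc, hy0, Fin.init]
  have hsum := Finset.sum_nonneg fun i (_ : i ∈ Finset.univ) => hnn i
  have hs : ∑ i, A i (Fin.last n) * A i (Fin.last n) = 1 := by rw [← hA, hX1]
  have hxx : ∑ i, A i (Fin.last n) * Matrix.toBilin' (B k) (A i) x =
      Matrix.toBilin' (B k) x x := by
    conv_rhs => rw [show Matrix.toBilin' (B k) x = ∑ i, A i (Fin.last n) •
      Matrix.toBilin' (B k) (A i) by simp only [x, map_sum, map_smul]]
    simp [LinearMap.sum_apply]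
  have hexp : ∀ i, Matrix.toBilin' (B k) (A i - A i (Fin.last n) • x)
      (A i - A i (Fin.last n) • x) = Matrix.toBilin' (B k) (A i) (A i) -
        2 * (A i (Fin.last n) * Matrix.toBilin' (B k) (A i) x) +
        (A i (Fin.last n) * A i (Fin.last n)) * Matrix.toBilin' (B k) x x := by
    intro i
    simp only [map_sub, map_smul, LinearMap.sub_apply, LinearMap.smul_apply, smul_eq_mul,
      toBilin'_comm (hsymm k) x (A i)]
    ring
  simp only [hexp, Finset.sum_add_distrib, Finset.sum_sub_distrib] at hsum
  rw [← Finset.mul_sum, hxx, ← Finset.sum_mul, hs] at hsum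
  linarith

/-- If the off-diagonal entries are nonpositive, the square roots of the diagonal of a feasible
matrix give a vector whose quadratic function values are no larger. -/
lemma exists_quadF_le_of_offDiag_nonpos {n : ℕ} {κ : Type*}
    (B : κ → Matrix (Fin (n + 1)) (Fin (n + 1)) ℝ)
    (hoff : ∀ k i j, i ≠ j → B k i j ≤ 0)
    {X : Matrix (Fin (n + 1)) (Fin (n + 1)) ℝ} (hX : X.PosSemidef)
    (hX1 : X (Fin.last n) (Fin.last n) = 1) :
    ∃ u : Fin n → ℝ, ∀ k, quadF (B k) u ≤ mInner (B k) X := by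
  obtain ⟨_, A, hA⟩ := exists_gram_of_posSemidef hX
  let x : Fin (n + 1) → ℝ := fun i => √(X i i)
  have hxs : (Fin.snoc (Fin.init x) 1 : Fin (n + 1) → ℝ) = x := by
    have hx1 : x (Fin.last n) = 1 := by simp [x, hX1]
    rw [← hx1]; exact Fin.snoc_init_self x
  have hdiag : ∀ i, 0 ≤ X i i := fun i => by
    rw [hA]; exact Finset.sum_nonneg fun k _ => mul_self_nonneg _
  refine ⟨Fin.init x, fun k => ?_⟩
  rw [quadF, hxs, ← mInner_vecMulVec]
  refine Finset.sum_le_sum fun i _ => Finset.sum_le_sum fun j _ => ?_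
  rw [Matrix.vecMulVec_apply]
  by_cases hij : i = j
  · subst hij
    rw [Real.mul_self_sqrt (hdiag i)]
  · refine mul_le_mul_of_nonpos_left ?_ (hoff k i j hij)
    rw [← Real.sqrt_mul (hdiag i)]
    refine Real.le_sqrt_of_sq_le ?_
    simp only [hA, ← sq]
    exact Finset.sum_mul_sq_le_sq_mul_sq _ _ _

end SemidefiniteMatrices

/-- **Example 5.2.** Under the structural conditions (19)–(25), if the SDP relaxation of
the horizontally connected QCQP admits an optimal solution, then it is exact. -/
theorem example52_sdpr_exact
    (n1 n2 nb1 nb2 nb3 : ℕ)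
    (B1 : Fin 8 → Matrix (Fin (n1 + 1)) (Fin (n1 + 1)) ℝ)
    (B2 : Fin 8 → Matrix (Fin (n2 + 1)) (Fin (n2 + 1)) ℝ)
    (C1 : Fin 8 → Matrix (Fin nb1) (Fin nb1) ℝ)
    (C2 : Fin 8 → Matrix (Fin nb2) (Fin nb2) ℝ)
    (C3 : Fin 8 → Matrix (Fin nb3) (Fin nb3) ℝ)
    (γ : Fin 7 → ℝ)
    (hB1symm : ∀ k, (B1 k).IsSymm)
    (hB1corner : ∀ k, B1 k (Fin.last n1) (Fin.last n1) = 0)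
    (hB2symm : ∀ k, (B2 k).IsSymm)
    (hB2corner : ∀ k, B2 k (Fin.last n2) (Fin.last n2) = 0)
    (hC1symm : ∀ k, (C1 k).IsSymm)
    (hC2symm : ∀ k, (C2 k).IsSymm)
    (hC3symm : ∀ k, (C3 k).IsSymm)
    -- (19): each f¹ₖ is convex and B¹₁ = B¹₂ = O
    (h19a : ∀ k, ((B1 k).submatrix Fin.castSucc Fin.castSucc).PosSemidef)
    (h19b : B1 1 = 0) (h19c : B1 2 = 0)
    -- (20): all off-diagonal elements of B²ₖ are nonpositive and B²₁ = B²₂ = O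
    (h20a : ∀ (k : Fin 8) (i j : Fin (n2 + 1)), i ≠ j → B2 k i j ≤ 0)
    (h20b : B2 1 = 0) (h20c : B2 2 = 0)
    -- (21): C²₁ = O, C³₁ = O, γ₁ ≠ 0
    (h21a : C2 1 = 0) (h21b : C3 1 = 0) (h21c : γ 0 ≠ 0)
    -- (22): C¹₂ and C³₂ are negative semidefinite, γ₂ > 0
    (h22a : (-(C1 2)).PosSemidef) (h22b : (-(C3 2)).PosSemidef) (h22c : 0 < γ 1)
    -- (23): B¹₃, B²₃, C¹₃, C²₃ are positive semidefinite, γ₃ < 0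
    (h23a : (B1 3).PosSemidef) (h23b : (B2 3).PosSemidef)
    (h23c : (C1 3).PosSemidef) (h23d : (C2 3).PosSemidef) (h23e : γ 2 < 0)
    -- (24): C^q₅ = α C^q₄ for some α > 0
    (h24 : ∃ α : ℝ, 0 < α ∧ C1 5 = α • C1 4 ∧ C2 5 = α • C2 4 ∧ C3 5 = α • C3 4)
    -- (25): C^q₆ = C^q₇ = O
    (h25a : C1 6 = 0) (h25b : C1 7 = 0) (h25c : C2 6 = 0) (h25d : C2 7 = 0)
    (h25e : C3 6 = 0) (h25f : C3 7 = 0)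
    -- the SDP relaxation admits an optimal solution
    (hopt : ∃ (X1 : Matrix (Fin (n1 + 1)) (Fin (n1 + 1)) ℝ)
        (X2 : Matrix (Fin (n2 + 1)) (Fin (n2 + 1)) ℝ)
        (V1 : Matrix (Fin nb1) (Fin nb1) ℝ) (V2 : Matrix (Fin nb2) (Fin nb2) ℝ)
        (V3 : Matrix (Fin nb3) (Fin nb3) ℝ),
      exSDPRFeas n1 n2 nb1 nb2 nb3 B1 B2 C1 C2 C3 γ X1 X2 V1 V2 V3 ∧
      ((exLin n1 n2 nb1 nb2 nb3 B1 B2 C1 C2 C3 X1 X2 V1 V2 V3 0 : ℝ) : EReal) =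
        exSDPRVal n1 n2 nb1 nb2 nb3 B1 B2 C1 C2 C3 γ) :
    exSDPRVal n1 n2 nb1 nb2 nb3 B1 B2 C1 C2 C3 γ =
      exQCQPVal n1 n2 nb1 nb2 nb3 B1 B2 C1 C2 C3 γ := by
  refine le_antisymm ?_ ?_
  · refine le_sInf ?_
    rintro _ ⟨u1, u2, v1, v2, v3, hfeas, rfl⟩
    have hlin : ∀ k, exLin n1 n2 nb1 nb2 nb3 B1 B2 C1 C2 C3
        (Matrix.vecMulVec (Fin.snoc u1 1) (Fin.snoc u1 1))
        (Matrix.vecMulVec (Fin.snoc u2 1) (Fin.snoc u2 1))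
        (Matrix.vecMulVec v1 v1) (Matrix.vecMulVec v2 v2) (Matrix.vecMulVec v3 v3) k =
        exQuad n1 n2 nb1 nb2 nb3 B1 B2 C1 C2 C3 u1 u2 v1 v2 v3 k := by
      intro k
      simp only [exLin, exQuad, mInner_vecMulVec, quadF]
    refine sInf_le ⟨_, _, _, _, _, ⟨posSemidef_vecMulVec_self _, ?_,
      posSemidef_vecMulVec_self _, ?_, posSemidef_vecMulVec_self _, posSemidef_vecMulVec_self _,
      posSemidef_vecMulVec_self _, fun k => ?_⟩, by rw [hlin 0]⟩
    · simp [Matrix.vecMulVec_apply]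
    · simp [Matrix.vecMulVec_apply]
    · rw [hlin]; exact hfeas k
  obtain ⟨X1, X2, V1, V2, V3, ⟨hX1, hX1c, hX2, hX2c, hV1, hV2, hV3, hrel⟩, hval⟩ := hopt
  obtain ⟨α, -, hα1, hα2, hα3⟩ := h24
  obtain ⟨u1, hu1⟩ := exists_quadF_le_of_convex B1 hB1symm h19a hX1 hX1c
  obtain ⟨u2, hu2⟩ := exists_quadF_le_of_offDiag_nonpos B2 h20a hX2 hX2c
  obtain ⟨l1, hl1⟩ := exists_list_of_posSemidef hV1
  obtain ⟨l2, hl2⟩ := exists_list_of_posSemidef hV2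
  obtain ⟨l3, hl3⟩ := exists_list_of_posSemidef hV3
  let ι : Fin 5 → Fin 8 := Fin.castLE (by norm_num)
  let P : Fin 5 → LinearMap.BilinForm ℝ (Fin nb1 → ℝ) := fun k => Matrix.toBilin' (C1 (ι k))
  let Q : Fin 5 → LinearMap.BilinForm ℝ (Fin nb2 → ℝ) := fun k => Matrix.toBilin' (C2 (ι k))
  let R : Fin 5 → LinearMap.BilinForm ℝ (Fin nb3 → ℝ) := fun k => Matrix.toBilin' (C3 (ι k))
  let b : Fin 4 → ℝ := fun j =>
    squareSum (P j.succ) l1 + squareSum (Q j.succ) l2 + squareSum (R j.succ) l3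
  let val : List (Fin nb1 → ℝ) → List (Fin nb2 → ℝ) → List (Fin nb3 → ℝ) → Fin 8 → ℝ :=
    fun m1 m2 m3 k => quadF (B1 k) u1 + quadF (B2 k) u2 +
      squareSum (Matrix.toBilin' (C1 k)) m1 + squareSum (Matrix.toBilin' (C2 k)) m2 +
      squareSum (Matrix.toBilin' (C3 k)) m3
  have hcon : ∀ m1 m2 m3, (∀ j : Fin 4, squareSum (P j.succ) m1 + squareSum (Q j.succ) m2 +
      squareSum (R j.succ) m3 = b j) → ∀ k : Fin 7, relEx k (val m1 m2 m3 k.succ) (γ k) := by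
    intro m1 m2 m3 hm k
    have hk := hrel k
    have hb1 := hu1 k.succ
    have hb2 := hu2 k.succ
    have hm1 : squareSum (Matrix.toBilin' (C1 1)) m1 + squareSum (Matrix.toBilin' (C2 1)) m2 +
      squareSum (Matrix.toBilin' (C3 1)) m3 = mInner (C1 1) V1 + mInner (C2 1) V2 +
        mInner (C3 1) V3 := by rw [← hl1, ← hl2, ← hl3]; exact hm 0
    have hm2 : squareSum (Matrix.toBilin' (C1 2)) m1 + squareSum (Matrix.toBilin' (C2 2)) m2 +
      squareSum (Matrix.toBilin' (C3 2)) m3 = mInner (C1 2) V1 + mInner (C2 2) V2 +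
        mInner (C3 2) V3 := by rw [← hl1, ← hl2, ← hl3]; exact hm 1
    have hm3 : squareSum (Matrix.toBilin' (C1 3)) m1 + squareSum (Matrix.toBilin' (C2 3)) m2 +
      squareSum (Matrix.toBilin' (C3 3)) m3 = mInner (C1 3) V1 + mInner (C2 3) V2 +
        mInner (C3 3) V3 := by rw [← hl1, ← hl2, ← hl3]; exact hm 2
    have hm4 : squareSum (Matrix.toBilin' (C1 4)) m1 + squareSum (Matrix.toBilin' (C2 4)) m2 +
      squareSum (Matrix.toBilin' (C3 4)) m3 = mInner (C1 4) V1 + mInner (C2 4) V2 +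
        mInner (C3 4) V3 := by rw [← hl1, ← hl2, ← hl3]; exact hm 3
    have hm5 : squareSum (Matrix.toBilin' (C1 5)) m1 + squareSum (Matrix.toBilin' (C2 5)) m2 +
      squareSum (Matrix.toBilin' (C3 5)) m3 = mInner (C1 5) V1 + mInner (C2 5) V2 +
        mInner (C3 5) V3 := by
      simp only [← hl1, ← hl2, ← hl3] at hm4 ⊢
      simp only [hα1, hα2, hα3, squareSum_toBilin'_smul]
      linear_combination α * hm4
    have hq1 : quadF (0 : Matrix (Fin (n1 + 1)) (Fin (n1 + 1)) ℝ) u1 = 0 := by simp [quadF]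
    have hq2 : quadF (0 : Matrix (Fin (n2 + 1)) (Fin (n2 + 1)) ℝ) u2 = 0 := by simp [quadF]
    fin_cases k
    · change exLin n1 n2 nb1 nb2 nb3 B1 B2 C1 C2 C3 X1 X2 V1 V2 V3 1 = γ 0 at hk
      change val m1 m2 m3 1 = γ 0
      simp only [exLin, val, h19b, h20b, hq1, hq2, mInner_zero_left] at hk ⊢
      linarith
    · change γ 1 ≤ exLin n1 n2 nb1 nb2 nb3 B1 B2 C1 C2 C3 X1 X2 V1 V2 V3 2 at hk
      change γ 1 ≤ val m1 m2 m3 2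
      simp only [exLin, val, h19c, h20c, hq1, hq2, mInner_zero_left] at hk ⊢
      linarith
    · change exLin n1 n2 nb1 nb2 nb3 B1 B2 C1 C2 C3 X1 X2 V1 V2 V3 3 ≤ γ 2 at hk
      change quadF (B1 3) u1 ≤ mInner (B1 3) X1 at hb1
      change quadF (B2 3) u2 ≤ mInner (B2 3) X2 at hb2
      change val m1 m2 m3 3 ≤ γ 2
      simp only [exLin, val] at hk ⊢
      linarith
    · change exLin n1 n2 nb1 nb2 nb3 B1 B2 C1 C2 C3 X1 X2 V1 V2 V3 4 ≤ γ 3 at hk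
      change quadF (B1 4) u1 ≤ mInner (B1 4) X1 at hb1
      change quadF (B2 4) u2 ≤ mInner (B2 4) X2 at hb2
      change val m1 m2 m3 4 ≤ γ 3
      simp only [exLin, val] at hk ⊢
      linarith
    · change exLin n1 n2 nb1 nb2 nb3 B1 B2 C1 C2 C3 X1 X2 V1 V2 V3 5 ≤ γ 4 at hk
      change quadF (B1 5) u1 ≤ mInner (B1 5) X1 at hb1
      change quadF (B2 5) u2 ≤ mInner (B2 5) X2 at hb2
      change val m1 m2 m3 5 ≤ γ 4
      simp only [exLin, val] at hk ⊢
      linarith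
    · change exLin n1 n2 nb1 nb2 nb3 B1 B2 C1 C2 C3 X1 X2 V1 V2 V3 6 ≤ γ 5 at hk
      change quadF (B1 6) u1 ≤ mInner (B1 6) X1 at hb1
      change quadF (B2 6) u2 ≤ mInner (B2 6) X2 at hb2
      change val m1 m2 m3 6 ≤ γ 5
      simp only [exLin, val, h25a, h25c, h25e, mInner_zero_left, squareSum_toBilin'_zero] at hk ⊢
      linarith
    · change exLin n1 n2 nb1 nb2 nb3 B1 B2 C1 C2 C3 X1 X2 V1 V2 V3 7 ≤ γ 6 at hk
      change quadF (B1 7) u1 ≤ mInner (B1 7) X1 at hb1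
      change quadF (B2 7) u2 ≤ mInner (B2 7) X2 at hb2
      change val m1 m2 m3 7 ≤ γ 6
      simp only [exLin, val, h25b, h25d, h25f, mInner_zero_left, squareSum_toBilin'_zero] at hk ⊢
      linarith
  obtain ⟨v1, v2, v3, hv, hvobj⟩ : ∃ v1 v2 v3,
      (∀ j : Fin 4, P j.succ v1 v1 + Q j.succ v2 v2 + R j.succ v3 v3 = b j) ∧
      P 0 v1 v1 + Q 0 v2 v2 + R 0 v3 v3 ≤
        exLin n1 n2 nb1 nb2 nb3 B1 B2 C1 C2 C3 X1 X2 V1 V2 V3 0 -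
          quadF (B1 0) u1 - quadF (B2 0) u2 := by
    refine exists_rank_one_solution P Q R
      (fun k => toBilin'_comm (hC1symm _)) (fun k => toBilin'_comm (hC2symm _))
      (fun k => toBilin'_comm (hC3symm _)) b _
      (fun m1 m2 m3 hm => ?_) (fun m1 m2 m3 hm => ?_) l1 l2 l3 (fun _ => rfl) ?_
    · have c0 : val m1 m2 m3 1 = γ 0 := hcon m1 m2 m3 hm 0
      have c1 : γ 1 ≤ val m1 m2 m3 2 := hcon m1 m2 m3 hm 1
      have c2 : val m1 m2 m3 3 ≤ γ 2 := hcon m1 m2 m3 hm 2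
      simp only [val, quadF, h19b, h20b, h21a, h21b, h19c, h20c, squareSum_toBilin'_zero,
        Matrix.zero_mulVec, dotProduct_zero, zero_add, add_zero] at c0 c1 c2
      refine ⟨?_, ?_, ?_⟩
      · rintro rfl
        exact h21c (by simpa using c0.symm)
      · rintro rfl
        have g1 := squareSum_nonneg h22a m1
        have g3 := squareSum_nonneg h22b m3
        rw [squareSum_toBilin'_neg] at g1 g3
        rw [squareSum_nil] at c1
        linarith
      · rintro rfl
        have g1 := dotProduct_mulVec_nonneg h23a (Fin.snoc u1 1)
        have g2 := dotProduct_mulVec_nonneg h23b (Fin.snoc u2 1)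
        have g3 := squareSum_nonneg h23c m1
        have g4 := squareSum_nonneg h23d m2
        rw [squareSum_nil] at c2
        linarith
    · obtain ⟨W1, hW1, hW1'⟩ := exists_posSemidef_of_list m1
      obtain ⟨W2, hW2, hW2'⟩ := exists_posSemidef_of_list m2
      obtain ⟨W3, hW3, hW3'⟩ := exists_posSemidef_of_list m3
      have hlin : ∀ k, exLin n1 n2 nb1 nb2 nb3 B1 B2 C1 C2 C3
          (Matrix.vecMulVec (Fin.snoc u1 1) (Fin.snoc u1 1))
          (Matrix.vecMulVec (Fin.snoc u2 1) (Fin.snoc u2 1)) W1 W2 W3 k = val m1 m2 m3 k := by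
        intro k
        simp only [exLin, val, mInner_vecMulVec, quadF, hW1', hW2', hW3']
      have hle : exSDPRVal n1 n2 nb1 nb2 nb3 B1 B2 C1 C2 C3 γ ≤ ((val m1 m2 m3 0 : ℝ) : EReal) := by
        refine sInf_le ⟨_, _, W1, W2, W3, ⟨posSemidef_vecMulVec_self (Fin.snoc u1 1), ?_,
          posSemidef_vecMulVec_self (Fin.snoc u2 1), ?_, hW1, hW2, hW3, fun k => ?_⟩,
          by rw [hlin 0]⟩
        · simp [Matrix.vecMulVec_apply]
        · simp [Matrix.vecMulVec_apply]
        · rw [hlin]; exact hcon m1 m2 m3 hm k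
      rw [← hval, EReal.coe_le_coe_iff] at hle
      simp only [val] at hle
      change _ ≤ squareSum (Matrix.toBilin' (C1 0)) m1 + squareSum (Matrix.toBilin' (C2 0)) m2 +
        squareSum (Matrix.toBilin' (C3 0)) m3
      linarith
    · change squareSum (Matrix.toBilin' (C1 0)) l1 + squareSum (Matrix.toBilin' (C2 0)) l2 +
        squareSum (Matrix.toBilin' (C3 0)) l3 ≤ _
      rw [hl1, hl2, hl3]
      simp only [exLin]
      linarith [hu1 0, hu2 0]
  rw [← hval]
  refine sInf_le_of_le ⟨u1, u2, v1, v2, v3, fun k => ?_, rfl⟩ (EReal.coe_le_coe_iff.2 ?_)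
  · have := hcon [v1] [v2] [v3] (fun j => by simpa using hv j) k
    simpa only [val, exQuad, squareSum_cons, squareSum_nil, add_zero, toBilin'_self] using this
  · simp only [P, Q, R, toBilin'_self] at hvobj
    change v1 ⬝ᵥ (C1 0 *ᵥ v1) + v2 ⬝ᵥ (C2 0 *ᵥ v2) + v3 ⬝ᵥ (C3 0 *ᵥ v3) ≤ _ at hvobj
    simp only [exQuad]
    linarith
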